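/- arXiv:1102.0877 — 5 statements merged into one kernel-verified Lean document; each statement's English description precedes it below -/
import Mathlib

section
/- Let ε > 0 and M ≥ 0. Then there exist constants R₁ > 0 and γ > 0, depending only on ε and M, with the following property: for every locally absolutely continuous function Λ : [0,∞) → [0,∞) and every locally integrable function φ : [0,∞) → [0,∞) such that Λ'(t) + ε·Λ(t) ≤ φ(t) for almost every t ≥ 0 and sup_{t ≥ 0} ∫_t^{t+1} φ(τ) dτ ≤ M, and for every R ≥ 0 with Λ(0) ≤ R, one has Λ(t) ≤ R₁ for all t ≥ R^{1/γ}·(1 + γM)^{-1}. -/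
open Real MeasureTheory

theorem sub_le_integral_sub_mul {Λ Λ' φ : ℝ → ℝ} {a b c : ℝ} (hab : a ≤ b)
    (hφ : IntervalIntegrable φ volume a b) (hΛ' : IntervalIntegrable Λ' volume a b)
    (hΛ : Λ b - Λ a = ∫ s in a..b, Λ' s)
    (hle : ∀ᵐ s : ℝ, s ∈ Set.Icc a b → Λ' s ≤ φ s - c) :
    Λ b - Λ a ≤ (∫ s in a..b, φ s) - c * (b - a) := by
  rw [hΛ]
  calc ∫ s in a..b, Λ' s ≤ ∫ s in a..b, (φ s - c) :=
        intervalIntegral.integral_mono_ae_restrict hab hΛ'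
          (hφ.sub intervalIntegrable_const)
          ((ae_restrict_iff' measurableSet_Icc).2 hle)
    _ = (∫ s in a..b, φ s) - c * (b - a) := by
        rw [intervalIntegral.integral_sub hφ intervalIntegrable_const,
          intervalIntegral.integral_const, smul_eq_mul, mul_comm]

theorem integral_le_of_unit_integral_le {φ : ℝ → ℝ} {M a b : ℝ} (ha : 0 ≤ a)
    (hab : a ≤ b) (hba : b ≤ a + 1) (hφ0 : ∀ t ≥ (0 : ℝ), 0 ≤ φ t)
    (hφ : IntervalIntegrable φ volume a (a + 1))
    (hM : (∫ s in a..(a + 1), φ s) ≤ M) :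
    (∫ s in a..b, φ s) ≤ M := by
  refine le_trans (intervalIntegral.integral_mono_interval le_rfl hab hba ?_ hφ) hM
  exact (ae_restrict_iff' measurableSet_Ioc).2
    (Filter.Eventually.of_forall fun s hs => hφ0 s (ha.trans hs.1.le))

theorem le_geometric_of_step {u : ℕ → ℝ} {q K : ℝ} (hq : 0 ≤ q)
    (hu : ∀ n, q * (u (n + 1) - K) ≤ u n - K) (n : ℕ) :
    q ^ n * (u n - K) ≤ u 0 - K := by
  induction n with
  | zero => simp
  | succ n ih =>
    calc q ^ (n + 1) * (u (n + 1) - K) = q ^ n * (q * (u (n + 1) - K)) := by ring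
      _ ≤ q ^ n * (u n - K) := by gcongr; exact hu n
      _ ≤ u 0 - K := ih

/-- Gronwall-type lemma (Lemma 2.5 in [GGP]): if `Λ' + εΛ ≤ φ` a.e. with
`sup_t ∫_t^{t+1} φ ≤ M`, then `Λ(t) ≤ R₁` for all `t ≥ R^{1/γ}(1+γM)⁻¹`
whenever `Λ(0) ≤ R`, with `R₁, γ` depending only on `ε, M`. -/
theorem gronwall_type_lemma (ε M : ℝ) (hε : 0 < ε) (hM : 0 ≤ M) :
    ∃ R₁ > (0:ℝ), ∃ γ > (0:ℝ),
      ∀ (Λ Λ' φ : ℝ → ℝ),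
        (∀ t ≥ (0:ℝ), 0 ≤ Λ t) →
        (∀ t ≥ (0:ℝ), 0 ≤ φ t) →
        (∀ a b : ℝ, 0 ≤ a → a ≤ b → IntervalIntegrable φ volume a b) →
        (∀ a b : ℝ, 0 ≤ a → a ≤ b → IntervalIntegrable Λ' volume a b) →
        -- local absolute continuity of `Λ` on `[0,∞)`, with a.e. derivative `Λ'`
        (∀ a b : ℝ, 0 ≤ a → a ≤ b → Λ b - Λ a = ∫ s in a..b, Λ' s) →
        (∀ᵐ t : ℝ, 0 ≤ t → Λ' t + ε * Λ t ≤ φ t) →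
        (∀ t ≥ (0:ℝ), (∫ s in t..(t + 1), φ s) ≤ M) →
        ∀ R ≥ (0:ℝ), Λ 0 ≤ R →
          ∀ t : ℝ, R ^ (1 / γ) * (1 + γ * M)⁻¹ ≤ t → Λ t ≤ R₁ := by
  have hK : 0 ≤ M * (1 + ε) / ε := by positivity
  refine ⟨M * (1 + ε) / ε + (1 + 2 * M) * (1 + 1 / ε), by positivity, 1, one_pos, ?_⟩
  intro Λ Λ' φ hΛ0 hφ0 hφ hΛ' hΛ hode hφM R hR hΛR t ht
  set K := M * (1 + ε) / ε with hKdef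
  have hεK : ε * K = M * (1 + ε) := by rw [hKdef]; field_simp
  have short : ∀ a b : ℝ, 0 ≤ a → a ≤ b → b ≤ a + 1 → Λ b - Λ a ≤ M := by
    intro a b ha hab hba
    have h := sub_le_integral_sub_mul (c := 0) hab (hφ a b ha hab) (hΛ' a b ha hab)
      (hΛ a b ha hab) (by
        filter_upwards [hode] with s hs hsab
        have hs0 : 0 ≤ s := ha.trans hsab.1
        linarith [hs hs0, mul_nonneg hε.le (hΛ0 s hs0)])
    linarith [integral_le_of_unit_integral_le ha hab hba hφ0
      (hφ a (a + 1) ha (by linarith)) (hφM a ha)]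
  have step : ∀ a : ℝ, 0 ≤ a → (1 + ε) * (Λ (a + 1) - K) ≤ Λ a - K := by
    intro a ha
    have hab : a ≤ a + 1 := by linarith
    have h := sub_le_integral_sub_mul (c := ε * (Λ (a + 1) - M)) hab (hφ _ _ ha hab)
      (hΛ' _ _ ha hab) (hΛ _ _ ha hab) (by
        filter_upwards [hode] with s hs hsab
        have hs0 : 0 ≤ s := ha.trans hsab.1
        have h1 := mul_le_mul_of_nonneg_left
          (short s (a + 1) hs0 hsab.2 (by linarith [hsab.1])) hε.le
        linarith [hs hs0])
    linarith [hφM a ha]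
  have hM1 : 0 < 1 + M := by linarith
  rw [one_mul, div_one, Real.rpow_one, ← div_eq_mul_inv] at ht
  have ht0 : 0 ≤ t := le_trans (by positivity) ht
  have hRt : R ≤ t * (1 + M) := (div_le_iff₀ hM1).1 ht
  set n := ⌊t⌋₊
  have hnt : (n : ℝ) ≤ t := Nat.floor_le ht0
  have htn : t < n + 1 := Nat.lt_floor_add_one t
  have hn : (0 : ℝ) ≤ n := n.cast_nonneg
  have decay := le_geometric_of_step (u := fun k => Λ (t - n + k)) (q := 1 + ε) (K := K)
    (by linarith)
    (fun k => by
      have := step (t - n + k) (add_nonneg (by linarith) k.cast_nonneg)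
      simpa [add_assoc] using this) n
  simp only [sub_add_cancel, Nat.cast_zero, add_zero] at decay
  have hstart := short 0 (t - n) le_rfl (by linarith) (by linarith)
  rcases le_or_gt (Λ t) K with hle | hlt
  · have : 0 ≤ (1 + 2 * M) * (1 + 1 / ε) := by positivity
    linarith
  · have hbern : 1 + n * ε ≤ (1 + ε) ^ n :=
      one_add_mul_le_pow (by linarith) n
    have hlin : (n : ℝ) + 1 ≤ (1 + 1 / ε) * (1 + n * ε) := by
      have : (1 + 1 / ε) * (1 + n * ε) = n + 1 + (n * ε + 1 / ε) := by field_simp; ring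
      rw [this]
      have : 0 ≤ n * ε + 1 / ε := by positivity
      linarith
    have hRn : R ≤ (n + 1) * (1 + M) := hRt.trans (by gcongr)
    have hpos : 0 < 1 + n * ε := by positivity
    have hbound : (1 + n * ε) * (Λ t - K) ≤
        (1 + n * ε) * ((1 + 2 * M) * (1 + 1 / ε)) :=
      calc (1 + n * ε) * (Λ t - K) ≤ (1 + ε) ^ n * (Λ t - K) :=
            mul_le_mul_of_nonneg_right hbern (by linarith)
        _ ≤ R + M := by linarith
        _ ≤ (1 + 2 * M) * (n + 1) := by linarith [mul_nonneg hM hn]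
        _ ≤ (1 + 2 * M) * ((1 + 1 / ε) * (1 + n * ε)) := by gcongr
        _ = (1 + n * ε) * ((1 + 2 * M) * (1 + 1 / ε)) := by ring
    linarith [le_of_mul_le_mul_left hbound hpos]
end

section
/- Let f : [0,∞) × [0,1] → ℝ be continuous and let u be a classical solution of the bridge equation with forcing term f. Then the energy t ↦ E(t) is differentiable on (0,∞) and satisfies the energy identity E'(t) + 2‖∂ₜu(t,·)‖² = 2⟨∂ₜu(t,·), f(t,·)⟩ for every t > 0. -/
open Real MeasureTheory

noncomputable section

/-- The `L²(0,1)` inner product `⟨u,v⟩`. -/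
def ipL2 (u v : ℝ → ℝ) : ℝ := ∫ x in (0:ℝ)..1, u x * v x

/-- The squared `L²(0,1)` norm `‖u‖²`. -/
def nsqL2 (u : ℝ → ℝ) : ℝ := ∫ x in (0:ℝ)..1, (u x) ^ 2

/-- Partial derivative in time. -/
def Dt (u : ℝ → ℝ → ℝ) : ℝ → ℝ → ℝ := fun t x => deriv (fun s => u s x) t

/-- Partial derivative in space. -/
def Dx (u : ℝ → ℝ → ℝ) : ℝ → ℝ → ℝ := fun t x => deriv (fun y => u t y) x

/-- A classical solution of the suspension-bridge equation
`∂ₜₜu + ∂ₓₓₓₓu + (p − ‖∂ₓu‖²)∂ₓₓu + ∂ₜu + k²u⁺ = f` on `[0,∞) × [0,1]`,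
smooth up to the boundary, with pinned boundary conditions. -/
def IsClassicalSolution (p k : ℝ) (f u : ℝ → ℝ → ℝ) : Prop :=
  ContDiff ℝ (⊤ : ℕ∞) (Function.uncurry u) ∧
  (∀ t ≥ (0:ℝ), ∀ x ∈ Set.Icc (0:ℝ) 1,
    Dt (Dt u) t x + Dx (Dx (Dx (Dx u))) t x
      + (p - nsqL2 (Dx u t)) * Dx (Dx u) t x
      + Dt u t x + k ^ 2 * max (u t x) 0 = f t x) ∧
  (∀ t ≥ (0:ℝ), u t 0 = 0 ∧ u t 1 = 0 ∧ Dx (Dx u) t 0 = 0 ∧ Dx (Dx u) t 1 = 0)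

/-- The energy `E(t) = ‖∂ₜu‖² + ‖∂ₓₓu‖² + ½(‖∂ₓu‖² − p)² + k²‖u⁺‖²`. -/
def energy (p k : ℝ) (u : ℝ → ℝ → ℝ) (t : ℝ) : ℝ :=
  nsqL2 (Dt u t) + nsqL2 (Dx (Dx u) t)
    + (1 / 2) * (nsqL2 (Dx u t) - p) ^ 2 + k ^ 2 * nsqL2 (fun x => max (u t x) 0)

/-- The reduced energy `𝓔(t) = ‖∂ₜu‖² + ‖∂ₓₓu‖²`. -/
def redEnergy (u : ℝ → ℝ → ℝ) (t : ℝ) : ℝ :=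
  nsqL2 (Dt u t) + nsqL2 (Dx (Dx u) t)

lemma contDiff_section_time {v : ℝ → ℝ → ℝ} (hv : ContDiff ℝ (⊤ : ℕ∞) (Function.uncurry v))
    (x : ℝ) : ContDiff ℝ (⊤ : ℕ∞) (fun s => v s x) :=
  hv.comp (contDiff_id.prodMk contDiff_const)

lemma contDiff_section_space {v : ℝ → ℝ → ℝ} (hv : ContDiff ℝ (⊤ : ℕ∞) (Function.uncurry v))
    (t : ℝ) : ContDiff ℝ (⊤ : ℕ∞) (v t) :=
  hv.comp (contDiff_const.prodMk contDiff_id)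

lemma hasDerivAt_Dt {v : ℝ → ℝ → ℝ} (hv : ContDiff ℝ (⊤ : ℕ∞) (Function.uncurry v)) (t x : ℝ) :
    HasDerivAt (fun s => v s x) (Dt v t x) t :=
  ((contDiff_section_time hv x).differentiable (by simp) t).hasDerivAt

lemma hasDerivAt_Dx {v : ℝ → ℝ → ℝ} (hv : ContDiff ℝ (⊤ : ℕ∞) (Function.uncurry v)) (t x : ℝ) :
    HasDerivAt (v t) (Dx v t x) x :=
  ((contDiff_section_space hv t).differentiable (by simp) x).hasDerivAt

lemma Dt_eq_fderiv {v : ℝ → ℝ → ℝ} (hv : ContDiff ℝ (⊤ : ℕ∞) (Function.uncurry v)) (t x : ℝ) :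
    Dt v t x = fderiv ℝ (Function.uncurry v) (t, x) (1, 0) := by
  have h := (hv.differentiable (by simp) (t, x)).hasFDerivAt.comp_hasDerivAt t
    ((hasDerivAt_id t).prodMk (hasDerivAt_const t x))
  exact h.deriv

lemma Dx_eq_fderiv {v : ℝ → ℝ → ℝ} (hv : ContDiff ℝ (⊤ : ℕ∞) (Function.uncurry v)) (t x : ℝ) :
    Dx v t x = fderiv ℝ (Function.uncurry v) (t, x) (0, 1) := by
  have h := (hv.differentiable (by simp) (t, x)).hasFDerivAt.comp_hasDerivAt x
    ((hasDerivAt_const x t).prodMk (hasDerivAt_id x))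
  exact h.deriv

lemma contDiff_Dt {v : ℝ → ℝ → ℝ} (hv : ContDiff ℝ (⊤ : ℕ∞) (Function.uncurry v)) :
    ContDiff ℝ (⊤ : ℕ∞) (Function.uncurry (Dt v)) := by
  have h : Function.uncurry (Dt v) = fun z => fderiv ℝ (Function.uncurry v) z (1, 0) :=
    funext fun z => Dt_eq_fderiv hv z.1 z.2
  rw [h]
  exact (hv.fderiv_right (by simp)).clm_apply contDiff_const

lemma contDiff_Dx {v : ℝ → ℝ → ℝ} (hv : ContDiff ℝ (⊤ : ℕ∞) (Function.uncurry v)) :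
    ContDiff ℝ (⊤ : ℕ∞) (Function.uncurry (Dx v)) := by
  have h : Function.uncurry (Dx v) = fun z => fderiv ℝ (Function.uncurry v) z (0, 1) :=
    funext fun z => Dx_eq_fderiv hv z.1 z.2
  rw [h]
  exact (hv.fderiv_right (by simp)).clm_apply contDiff_const

/-- Time and space derivatives of a smooth function commute. -/
lemma Dt_Dx_comm {v : ℝ → ℝ → ℝ} (hv : ContDiff ℝ (⊤ : ℕ∞) (Function.uncurry v)) :
    Dt (Dx v) = Dx (Dt v) := by
  funext t x
  have hd : DifferentiableAt ℝ (fderiv ℝ (Function.uncurry v)) (t, x) :=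
    (hv.fderiv_right (m := (⊤ : ℕ∞)) (by simp)).differentiable (by simp) _
  have hsymm : IsSymmSndFDerivAt ℝ (Function.uncurry v) (t, x) :=
    hv.contDiffAt.isSymmSndFDerivAt 
      (by simpa using WithTop.coe_le_coe.2 (le_top : (2 : ℕ∞) ≤ ⊤))
  have hX : Function.uncurry (Dx v) = fun z => fderiv ℝ (Function.uncurry v) z (0, 1) :=
    funext fun z => Dx_eq_fderiv hv z.1 z.2
  have hT : Function.uncurry (Dt v) = fun z => fderiv ℝ (Function.uncurry v) z (1, 0) :=
    funext fun z => Dt_eq_fderiv hv z.1 z.2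
  rw [Dt_eq_fderiv (contDiff_Dx hv), Dx_eq_fderiv (contDiff_Dt hv), hX, hT,
    fderiv_clm_apply hd (differentiableAt_const _), fderiv_clm_apply hd (differentiableAt_const _)]
  simpa using hsymm.eq (1, 0) (0, 1)

/-- Differentiation under the integral sign for jointly continuous integrands. -/
lemma hasDerivAt_intervalIntegral_of_continuous {g g' : ℝ → ℝ → ℝ} {a b : ℝ}
    (hg : Continuous (Function.uncurry g)) (hg' : Continuous (Function.uncurry g'))
    (hd : ∀ t x, HasDerivAt (fun s => g s x) (g' t x) t) (t : ℝ) :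
    HasDerivAt (fun s => ∫ x in a..b, g s x) (∫ x in a..b, g' t x) t := by
  obtain ⟨C, hC⟩ := (isCompact_Icc (a := t - 1) (b := t + 1)).prod (isCompact_uIcc (a := a) (b := b))
    |>.exists_bound_of_continuousOn hg'.continuousOn
  have hsec (s : ℝ) : Continuous (g s) := hg.comp (Continuous.prodMk_right s)
  have hsec' (s : ℝ) : Continuous (g' s) := hg'.comp (Continuous.prodMk_right s)
  exact (intervalIntegral.hasDerivAt_integral_of_dominated_loc_of_deriv_le (bound := fun _ => C)
    (Icc_mem_nhds (by linarith : t - 1 < t) (by linarith : t < t + 1))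
    (.of_forall fun s => (hsec s).aestronglyMeasurable) ((hsec t).intervalIntegrable _ _)
    (hsec' t).aestronglyMeasurable
    (.of_forall fun x hx s hs => hC (s, x) ⟨hs, Set.uIoc_subset_uIcc hx⟩)
    intervalIntegrable_const (.of_forall fun x _ s _ => hd s x)).2

lemma hasDerivAt_nsqL2 {v : ℝ → ℝ → ℝ} (hv : ContDiff ℝ (⊤ : ℕ∞) (Function.uncurry v)) (t : ℝ) :
    HasDerivAt (fun s => nsqL2 (v s)) (2 * ipL2 (v t) (Dt v t)) t := by
  have hc := hv.continuous
  have hc' := (contDiff_Dt hv).continuous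
  have h := hasDerivAt_intervalIntegral_of_continuous (a := 0) (b := 1)
    (g := fun s x => v s x ^ 2) (g' := fun s x => 2 * (v s x * Dt v s x))
    (by exact hc.pow 2) (by exact continuous_const.mul (hc.mul hc'))
    (fun s x => by
      refine ((hasDerivAt_Dt hv s x).pow 2).congr_deriv ?_
      norm_num [mul_assoc]) t
  rw [intervalIntegral.integral_const_mul] at h
  exact h

lemma hasDerivAt_max_zero_sq (y : ℝ) : HasDerivAt (fun z : ℝ => max z 0 ^ 2) (2 * max y 0) y := by
  rcases lt_trichotomy y 0 with hy | rfl | hy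
  · rw [max_eq_right hy.le, mul_zero]
    refine (hasDerivAt_const y (0 : ℝ)).congr_of_eventuallyEq ?_
    filter_upwards [Iio_mem_nhds hy] with z hz
    simp [max_eq_right (Set.mem_Iio.1 hz).le]
  · rw [max_self, mul_zero, hasDerivAt_iff_isLittleO]
    have h : (fun z : ℝ => z ^ 2) =o[nhds 0] fun z : ℝ => z - 0 := by
      simpa using Asymptotics.isLittleO_pow_id (𝕜 := ℝ) (n := 2) (by norm_num)
    refine (Asymptotics.IsBigO.of_bound 1 (.of_forall fun z => ?_)).trans_isLittleO h
    rcases le_total z 0 with hz | hz <;> simp [hz]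
    positivity
  · rw [max_eq_left hy.le]
    refine (hasDerivAt_pow 2 y).congr_of_eventuallyEq ?_ |>.congr_deriv (by simp)
    filter_upwards [Ioi_mem_nhds hy] with z hz
    rw [max_eq_left (Set.mem_Ioi.1 hz).le]

lemma hasDerivAt_nsqL2_max_zero {v : ℝ → ℝ → ℝ}
    (hv : ContDiff ℝ (⊤ : ℕ∞) (Function.uncurry v)) (t : ℝ) :
    HasDerivAt (fun s => nsqL2 (fun x => max (v s x) 0))
      (2 * ipL2 (fun x => max (v t x) 0) (Dt v t)) t := by
  have hc := hv.continuous
  have hc' := (contDiff_Dt hv).continuous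
  have hm : Continuous fun z : ℝ × ℝ => max (Function.uncurry v z) 0 := hc.max continuous_const
  have h := hasDerivAt_intervalIntegral_of_continuous (a := 0) (b := 1)
    (g := fun s x => max (v s x) 0 ^ 2) (g' := fun s x => 2 * (max (v s x) 0 * Dt v s x))
    (by exact hm.pow 2) (by exact continuous_const.mul (hm.mul hc'))
    (fun s x => by
      have := (hasDerivAt_max_zero_sq (v s x)).comp s (hasDerivAt_Dt hv s x)
      rw [mul_assoc] at this
      exact this) t
  rw [intervalIntegral.integral_const_mul] at h
  exact h

/-- Integration by parts when the boundary terms vanish. -/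
lemma ipL2_deriv_right {a a' b b' : ℝ → ℝ} (ha : ∀ x, HasDerivAt a (a' x) x)
    (hb : ∀ x, HasDerivAt b (b' x) x) (ha' : Continuous a') (hb' : Continuous b')
    (h0 : a 0 * b 0 = 0) (h1 : a 1 * b 1 = 0) : ipL2 a b' = -ipL2 a' b := by
  have h := intervalIntegral.integral_mul_deriv_eq_deriv_mul (a := 0) (b := 1)
    (fun x _ => ha x) (fun x _ => hb x)
    (ha'.intervalIntegrable _ _) (hb'.intervalIntegrable _ _)
  rw [h0, h1] at h
  simpa [ipL2] using h

/-- A function vanishing at `x` for all nonnegative times has vanishing time derivative there. -/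
lemma Dt_eq_zero_of_forall_nonneg {v : ℝ → ℝ → ℝ} {x t : ℝ} (h : ∀ s ≥ (0 : ℝ), v s x = 0)
    (ht : 0 < t) : Dt v t x = 0 := by
  have he : (fun s => v s x) =ᶠ[nhds t] fun _ => 0 := by
    filter_upwards [Ioi_mem_nhds ht] with s hs using h s (le_of_lt hs)
  simpa [Dt] using he.deriv_eq

/-- The energy identity: along a classical solution, the energy is differentiable and
`E'(t) + 2‖∂ₜu(t,·)‖² = 2⟨∂ₜu(t,·), f(t,·)⟩` for every `t > 0`. -/
theorem energy_identity (p k : ℝ) (f u : ℝ → ℝ → ℝ)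
    (hf : Continuous (Function.uncurry f))
    (hu : IsClassicalSolution p k f u) :
    ∀ t > (0:ℝ), HasDerivAt (energy p k u)
      (2 * ipL2 (Dt u t) (f t) - 2 * nsqL2 (Dt u t)) t := by
  intro t ht
  obtain ⟨hs, hpde, hbc⟩ := hu
  have hut := contDiff_Dt hs
  have hux := contDiff_Dx hs
  have huxx := contDiff_Dx hux
  have huxxx := contDiff_Dx huxx
  have huxxxx := contDiff_Dx huxxx
  have hutx := contDiff_Dx hut
  have hutxx := contDiff_Dx hutx
  obtain ⟨-, -, hxx0, hxx1⟩ := hbc t ht.le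
  have hw0 : Dt u t 0 = 0 := Dt_eq_zero_of_forall_nonneg (fun s hs => (hbc s hs).1) ht
  have hw1 : Dt u t 1 = 0 := Dt_eq_zero_of_forall_nonneg (fun s hs => (hbc s hs).2.1) ht
  have hx : ipL2 (Dx u t) (Dt (Dx u) t) = -ipL2 (Dx (Dx u) t) (Dt u t) := by
    rw [Dt_Dx_comm hs]
    exact ipL2_deriv_right (hasDerivAt_Dx hux t) (hasDerivAt_Dx hut t)
      (contDiff_section_space huxx t).continuous (contDiff_section_space hutx t).continuous
      (by simp [hw0]) (by simp [hw1])
  have hxx : ipL2 (Dx (Dx u) t) (Dt (Dx (Dx u)) t) = ipL2 (Dx (Dx (Dx (Dx u))) t) (Dt u t) := by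
    rw [Dt_Dx_comm hux, Dt_Dx_comm hs,
      ipL2_deriv_right (hasDerivAt_Dx huxx t) (hasDerivAt_Dx hutx t)
        (contDiff_section_space huxxx t).continuous (contDiff_section_space hutxx t).continuous
        (by simp [hxx0]) (by simp [hxx1]),
      ipL2_deriv_right (hasDerivAt_Dx huxxx t) (hasDerivAt_Dx hut t)
        (contDiff_section_space huxxxx t).continuous (contDiff_section_space hutx t).continuous
        (by simp [hw0]) (by simp [hw1]), neg_neg]
  have hE := (((hasDerivAt_nsqL2 hut t).add (hasDerivAt_nsqL2 huxx t)).add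
    ((((hasDerivAt_nsqL2 hux t).sub_const p).pow 2).const_mul (1 / 2))).add
    ((hasDerivAt_nsqL2_max_zero hs t).const_mul (k ^ 2))
  refine HasDerivAt.congr_deriv (f := energy p k u) hE ?_
  rw [hx, hxx]
  have c0 := (contDiff_section_space hs t).continuous
  have c1 := (contDiff_section_space hut t).continuous
  have c2 := (contDiff_section_space (contDiff_Dt hut) t).continuous
  have c3 := (contDiff_section_space huxx t).continuous
  have c4 := (contDiff_section_space huxxxx t).continuous
  have hf' : ipL2 (Dt u t) (f t) =
      ipL2 (Dt u t) (Dt (Dt u) t) + ipL2 (Dx (Dx (Dx (Dx u))) t) (Dt u t)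
        + (p - nsqL2 (Dx u t)) * ipL2 (Dx (Dx u) t) (Dt u t)
        + nsqL2 (Dt u t) + k ^ 2 * ipL2 (fun x => max (u t x) 0) (Dt u t) := by
    have hint : ipL2 (Dt u t) (f t) = ∫ x in (0 : ℝ)..1,
        Dt u t x * Dt (Dt u) t x + Dx (Dx (Dx (Dx u))) t x * Dt u t x
          + (p - nsqL2 (Dx u t)) * (Dx (Dx u) t x * Dt u t x)
          + Dt u t x ^ 2 + k ^ 2 * (max (u t x) 0 * Dt u t x) := by
      refine intervalIntegral.integral_congr fun x hx => ?_
      rw [Set.uIcc_of_le zero_le_one] at hx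
      simp only [← hpde t ht.le x hx]
      ring
    rw [hint, intervalIntegral.integral_add, intervalIntegral.integral_add,
      intervalIntegral.integral_add, intervalIntegral.integral_add,
      intervalIntegral.integral_const_mul, intervalIntegral.integral_const_mul]
    · rfl
    all_goals exact Continuous.intervalIntegrable (by fun_prop) _ _
  rw [hf']
  simp
  ring
end
end

section
/- Let b, κ ∈ ℝ. Every u ∈ C⁴([0,1]) with u(0) = u(1) = u''(0) = u''(1) = 0 satisfying the stationary bridge equation u''''(x) + (bπ² − ∫₀¹ (u'(y))² dy)·u''(x) + κ²π⁴·max(u(x),0) = 0 for all x ∈ [0,1] obeys the bound ∫₀¹ (u''(x))² dx ≤ b²π⁴/4. In particular, the set of stationary solutions is bounded in the H² norm, uniformly for each fixed b, κ. -/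
open Real MeasureTheory

/-- The set of stationary solutions of the suspension-bridge problem is bounded in
`H²`: every `u ∈ C⁴([0,1])` with pinned ends solving
`u'''' + (bπ² − ‖u'‖²)u'' + κ²π⁴u⁺ = 0` on `[0,1]` satisfies
`∫₀¹ (u'')² ≤ b²π⁴/4`. -/
theorem stationary_solutions_bounded (b κ : ℝ) (u : ℝ → ℝ)
    (hu : ContDiff ℝ 4 u)
    (h0 : u 0 = 0) (h1 : u 1 = 0)
    (h0'' : deriv (deriv u) 0 = 0) (h1'' : deriv (deriv u) 1 = 0)
    (heq : ∀ x ∈ Set.Icc (0:ℝ) 1,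
      deriv (deriv (deriv (deriv u))) x
        + (b * π ^ 2 - ∫ y in (0:ℝ)..1, (deriv u y) ^ 2) * deriv (deriv u) x
        + κ ^ 2 * π ^ 4 * max (u x) 0 = 0) :
    (∫ x in (0:ℝ)..1, (deriv (deriv u) x) ^ 2) ≤ b ^ 2 * π ^ 4 / 4 := by
  have hu1 : ContDiff ℝ 3 (deriv u) := hu.deriv'
  have hu2 : ContDiff ℝ 2 (deriv (deriv u)) := hu1.deriv'
  have hu3 : ContDiff ℝ 1 (deriv (deriv (deriv u))) := hu2.deriv'
  have c4 : Continuous (deriv (deriv (deriv (deriv u)))) := hu3.continuous_deriv le_rfl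
  have c0 := hu.continuous
  have c1 := hu1.continuous
  have c2 := hu2.continuous
  have d0 : ∀ x, HasDerivAt u (deriv u x) x := fun x =>
    (hu.differentiable (by norm_num) x).hasDerivAt
  have d1 : ∀ x, HasDerivAt (deriv u) (deriv (deriv u) x) x := fun x =>
    (hu1.differentiable (by norm_num) x).hasDerivAt
  have d2 : ∀ x, HasDerivAt (deriv (deriv u)) (deriv (deriv (deriv u)) x) x := fun x =>
    (hu2.differentiable (by norm_num) x).hasDerivAt
  have d3 : ∀ x, HasDerivAt (deriv (deriv (deriv u))) (deriv (deriv (deriv (deriv u))) x) x :=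
    fun x => (hu3.differentiable (by norm_num) x).hasDerivAt
  set S := ∫ y in (0:ℝ)..1, (deriv u y) ^ 2 with hS
  set c := b * π ^ 2 - S with hc
  have energy : ∫ x in (0:ℝ)..1, (u x * deriv (deriv (deriv (deriv u))) x
      - deriv (deriv u) x ^ 2 + c * (u x * deriv (deriv u) x + deriv u x ^ 2)) = 0 := by
    have hF : ∀ x ∈ Set.uIcc (0:ℝ) 1, HasDerivAt
        (fun x => u x * deriv (deriv (deriv u)) x - deriv u x * deriv (deriv u) x
          + c * (u x * deriv u x))
        (u x * deriv (deriv (deriv (deriv u))) x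
          - deriv (deriv u) x ^ 2 + c * (u x * deriv (deriv u) x + deriv u x ^ 2)) x :=
      fun x _ => ((((d0 x).mul (d3 x)).sub ((d1 x).mul (d2 x))).add
        (((d0 x).mul (d1 x)).const_mul c)).congr_deriv (by ring)
    rw [intervalIntegral.integral_eq_sub_of_hasDerivAt hF
      (Continuous.intervalIntegrable (by fun_prop) _ _)]
    simp [h0, h1, h0'', h1'']
  have le : ∫ x in (0:ℝ)..1, (u x * deriv (deriv (deriv (deriv u))) x
      - deriv (deriv u) x ^ 2 + c * (u x * deriv (deriv u) x + deriv u x ^ 2)) ≤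
      ∫ x in (0:ℝ)..1, (c * deriv u x ^ 2 - deriv (deriv u) x ^ 2) := by
    refine intervalIntegral.integral_mono_on zero_le_one
      (Continuous.intervalIntegrable (by fun_prop) _ _)
      (Continuous.intervalIntegrable (by fun_prop) _ _) fun x hx => ?_
    have hmax : 0 ≤ u x * max (u x) 0 := by
      rcases le_total (u x) 0 with h | h
      · simp [h]
      · simpa [h] using mul_self_nonneg (u x)
    have hpos : 0 ≤ κ ^ 2 * π ^ 4 * (u x * max (u x) 0) := by positivity
    linear_combination u x * heq x hx + hpos
  rw [energy, intervalIntegral.integral_sub (Continuous.intervalIntegrable (by fun_prop) _ _)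
    (Continuous.intervalIntegrable (by fun_prop) _ _), intervalIntegral.integral_const_mul,
    ← hS, hc] at le
  nlinarith [sq_nonneg (b * π ^ 2 / 2 - S)]
end

section
/- Let b ≥ 2 and set A₁⁺ = √(2(b−2)). Then the function u(x) = A₁⁺·sin(πx) is a stationary solution of the bridge problem with κ = 1; that is, u ∈ C⁴([0,1]), u(0) = u(1) = u''(0) = u''(1) = 0, and u''''(x) + (bπ² − ∫₀¹ (u'(y))² dy)·u''(x) + π⁴·max(u(x),0) = 0 for all x ∈ [0,1]. -/
open Real MeasureTheory

noncomputable section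

/-- The buckled branch `u₁⁺(x) = A₁⁺ sin(πx)`, `A₁⁺ = √(2(b−2))`. -/
def buckledPlus (b : ℝ) : ℝ → ℝ := fun x => Real.sqrt (2 * (b - 2)) * Real.sin (π * x)

theorem deriv_const_mul_sin_mul (c a : ℝ) :
    deriv (fun x => c * Real.sin (a * x)) = fun x => c * a * Real.cos (a * x) := by
  ext x
  have h := ((Real.hasDerivAt_sin (a * x)).comp x ((hasDerivAt_id x).const_mul a)).const_mul c
  exact h.deriv.trans (by ring)

theorem deriv_const_mul_cos_mul (c a : ℝ) :
    deriv (fun x => c * Real.cos (a * x)) = fun x => -(c * a) * Real.sin (a * x) := by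
  ext x
  have h := ((Real.hasDerivAt_cos (a * x)).comp x ((hasDerivAt_id x).const_mul a)).const_mul c
  exact h.deriv.trans (by ring)

theorem deriv_deriv_const_mul_sin_mul (c a : ℝ) :
    deriv (deriv fun x => c * Real.sin (a * x)) =
      fun x => -(c * a * a) * Real.sin (a * x) := by
  rw [deriv_const_mul_sin_mul, deriv_const_mul_cos_mul]

theorem integral_cos_pi_mul_sq : ∫ y in (0:ℝ)..1, Real.cos (π * y) ^ 2 = 1 / 2 := by
  rw [intervalIntegral.integral_comp_mul_left (fun t => Real.cos t ^ 2) Real.pi_ne_zero,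
    integral_cos_sq]
  simp
  field_simp

/-- For `b ≥ 2`, the function `u(x) = √(2(b−2))·sin(πx)` is a stationary solution of
the bridge problem with `κ = 1`: it is `C⁴`, satisfies the pinned boundary conditions,
and solves `u'''' + (bπ² − ‖u'‖²)u'' + π⁴u⁺ = 0` on `[0,1]`. -/
theorem buckledPlus_is_stationary (b : ℝ) (hb : 2 ≤ b) :
    ContDiff ℝ 4 (buckledPlus b) ∧
    buckledPlus b 0 = 0 ∧ buckledPlus b 1 = 0 ∧
    deriv (deriv (buckledPlus b)) 0 = 0 ∧ deriv (deriv (buckledPlus b)) 1 = 0 ∧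
    ∀ x ∈ Set.Icc (0:ℝ) 1,
      deriv (deriv (deriv (deriv (buckledPlus b)))) x
        + (b * π ^ 2 - ∫ y in (0:ℝ)..1, (deriv (buckledPlus b) y) ^ 2)
            * deriv (deriv (buckledPlus b)) x
        + π ^ 4 * max (buckledPlus b x) 0 = 0 := by
  have hd := deriv_const_mul_sin_mul √(2 * (b - 2)) π
  have hdd := deriv_deriv_const_mul_sin_mul √(2 * (b - 2)) π
  have hA : √(2 * (b - 2)) ^ 2 = 2 * (b - 2) := Real.sq_sqrt (by linarith)
  unfold buckledPlus
  refine ⟨by fun_prop, by simp, by simp, by rw [hdd]; simp, by rw [hdd]; simp, fun x hx => ?_⟩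
  have hsin : 0 ≤ Real.sin (π * x) :=
    Real.sin_nonneg_of_nonneg_of_le_pi (mul_nonneg Real.pi_pos.le hx.1)
      (mul_le_of_le_one_right Real.pi_pos.le hx.2)
  rw [hdd, deriv_deriv_const_mul_sin_mul, hd, max_eq_left (mul_nonneg (Real.sqrt_nonneg _) hsin)]
  simp only [mul_pow, intervalIntegral.integral_const_mul, integral_cos_pi_mul_sq, hA]
  ring
end
end

section
/- Let p ∈ ℝ. For every u ∈ C¹([0,1]) with u(0) = u(1) = 0 and every v ∈ L²(0,1), one has |⟨u,v⟩| ≤ ½‖v‖² + ¼(‖u'‖² − p)² + |p|/(2π²) + 1/(2π⁴). -/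
open Real MeasureTheory

noncomputable section

/-- If `u` and `s` vanish at `a`, with `s` having nonzero derivative there, then `c u² / s`
(with value `0` at `a`) is continuous at `a`. -/
lemma continuousAt_mul_sq_div_of_hasDerivAt {u s c : ℝ → ℝ} {u' s' a : ℝ}
    (hu : HasDerivAt u u' a) (hs : HasDerivAt s s' a) (hua : u a = 0) (hsa : s a = 0)
    (hs' : s' ≠ 0) (hc : ContinuousAt c a) :
    ContinuousAt (fun x => c x * u x ^ 2 / s x) a := by
  rw [continuousAt_iff_punctured_nhds]
  have hslope := (hasDerivAt_iff_tendsto_slope.mp hu).div (hasDerivAt_iff_tendsto_slope.mp hs) hs'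
  have hlim := ((hc.mul hu.continuousAt).tendsto.mono_left
    (nhdsWithin_le_nhds (s := {a}ᶜ))).mul hslope
  simp only [Pi.mul_apply, hua, mul_zero, zero_mul] at hlim
  simp only [hsa, div_zero]
  refine hlim.congr' ?_
  filter_upwards [self_mem_nhdsWithin] with x hx
  have hxa : x - a ≠ 0 := sub_ne_zero.mpr hx
  simp only [Pi.div_apply, slope_def_field, hua, hsa, sub_zero]
  rw [div_div_div_cancel_right₀ hxa]
  ring

/-- The Poincaré inequality with its optimal constant for functions vanishing at `0` and `1`. -/
lemma pi_sq_mul_nsqL2_le_nsqL2_deriv {u : ℝ → ℝ} (hu : ContDiff ℝ 1 u)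
    (h0 : u 0 = 0) (h1 : u 1 = 0) : π ^ 2 * nsqL2 u ≤ nsqL2 (deriv u) := by
  have hd : ∀ x, HasDerivAt u (deriv u x) x := fun x =>
    (hu.differentiable one_ne_zero x).hasDerivAt
  have hdc : Continuous (deriv u) := hu.continuous_deriv le_rfl
  have hlin : ∀ x : ℝ, HasDerivAt (fun y : ℝ => π * y) π x := fun x => by
    simpa using (hasDerivAt_id x).const_mul π
  have hsin : ∀ x, HasDerivAt (fun y => sin (π * y)) (cos (π * x) * π) x := fun x =>
    (hlin x).sin
  have hcos : ∀ x, HasDerivAt (fun y => π * cos (π * y)) (π * (-sin (π * x) * π)) x := fun x =>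
    (hlin x).cos.const_mul π
  have hpos : ∀ x ∈ Set.Ioo (0 : ℝ) 1, 0 < sin (π * x) := fun x hx =>
    sin_pos_of_pos_of_lt_pi (mul_pos pi_pos hx.1) (by nlinarith [pi_pos, hx.2])
  have hderiv : ∀ x ∈ Set.Ioo (0 : ℝ) 1,
      HasDerivAt (fun y => π * cos (π * y) * u y ^ 2 / sin (π * y))
        (((π * (-sin (π * x) * π)) * u x ^ 2 + π * cos (π * x) * (2 * u x * deriv u x))
          / sin (π * x) - π * cos (π * x) * u x ^ 2 * (cos (π * x) * π) / sin (π * x) ^ 2) x := by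
    intro x hx
    have hne := (hpos x hx).ne'
    refine (((hcos x).mul ((hd x).pow 2)).div (hsin x) hne).congr_deriv ?_
    simp only [Pi.mul_apply, Pi.pow_apply]
    field_simp
    norm_num
    ring
  have hcont : ContinuousOn (fun y => π * cos (π * y) * u y ^ 2 / sin (π * y))
      (Set.Icc 0 1) := by
    intro x hx
    refine ContinuousAt.continuousWithinAt ?_
    rcases hx.1.eq_or_lt with rfl | hx0
    · exact continuousAt_mul_sq_div_of_hasDerivAt (hd 0) (hsin 0) h0 (by simp)
        (by simp [pi_ne_zero]) (hcos 0).continuousAt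
    rcases hx.2.eq_or_lt with rfl | hx1
    · exact continuousAt_mul_sq_div_of_hasDerivAt (hd 1) (hsin 1) h1 (by simp)
        (by simp [pi_ne_zero]) (hcos 1).continuousAt
    · exact (hderiv x ⟨hx0, hx1⟩).continuousAt
  have hφ : Continuous fun x => deriv u x ^ 2 - π ^ 2 * u x ^ 2 :=
    (hdc.pow 2).sub (continuous_const.mul (hu.continuous.pow 2))
  have key := intervalIntegral.sub_le_integral_of_hasDeriv_right_of_le zero_le_one hcont
    (fun x hx => (hderiv x hx).hasDerivWithinAt) (hφ.integrableOn_Icc) (fun x hx => by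
      have hs := hpos x hx
      have hid : deriv u x ^ 2 - π ^ 2 * u x ^ 2
          - (((π * (-sin (π * x) * π)) * u x ^ 2 + π * cos (π * x) * (2 * u x * deriv u x))
          / sin (π * x) - π * cos (π * x) * u x ^ 2 * (cos (π * x) * π) / sin (π * x) ^ 2)
          = (deriv u x - π * u x * cos (π * x) / sin (π * x)) ^ 2 := by
        field_simp
        ring
      linarith [sq_nonneg (deriv u x - π * u x * cos (π * x) / sin (π * x))])
  have hi : IntervalIntegrable (fun x => deriv u x ^ 2) volume 0 1 :=
    (hdc.pow 2).intervalIntegrable _ _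
  have hj : IntervalIntegrable (fun x => π ^ 2 * u x ^ 2) volume 0 1 :=
    (continuous_const.mul (hu.continuous.pow 2)).intervalIntegrable _ _
  rw [intervalIntegral.integral_sub hi hj, intervalIntegral.integral_const_mul] at key
  simp only [h0, h1] at key
  unfold nsqL2
  norm_num at key
  exact key

/-- Young's inequality for the `L²(0,1)` inner product. -/
lemma abs_ipL2_le {u v : ℝ → ℝ}
    (hu : IntervalIntegrable (fun x => u x ^ 2) volume 0 1)
    (hv : IntervalIntegrable (fun x => v x ^ 2) volume 0 1) :
    |ipL2 u v| ≤ (1 / 2) * nsqL2 u + (1 / 2) * nsqL2 v := by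
  unfold ipL2 nsqL2
  rw [← intervalIntegral.integral_const_mul, ← intervalIntegral.integral_const_mul,
    ← intervalIntegral.integral_add (hu.const_mul _) (hv.const_mul _), ← Real.norm_eq_abs]
  refine intervalIntegral.norm_integral_le_of_norm_le zero_le_one
    (ae_of_all _ fun x _ => ?_) ((hu.const_mul _).add (hv.const_mul _))
  rw [Real.norm_eq_abs, abs_mul]
  nlinarith [sq_nonneg (|u x| - |v x|), sq_abs (u x), sq_abs (v x)]

/-- For `p ∈ ℝ`, `u ∈ C¹([0,1])` with `u(0) = u(1) = 0` and `v ∈ L²(0,1)`,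
`|⟨u,v⟩| ≤ ½‖v‖² + ¼(‖u'‖² − p)² + |p|/(2π²) + 1/(2π⁴)`. -/
theorem inner_bound_shifted (p : ℝ) (u v : ℝ → ℝ) (hu : ContDiff ℝ 1 u)
    (h0 : u 0 = 0) (h1 : u 1 = 0)
    (hvm : Measurable v) (hv2 : IntervalIntegrable (fun x => (v x) ^ 2) volume 0 1) :
    |ipL2 u v| ≤ (1 / 2) * nsqL2 v + (1 / 4) * (nsqL2 (deriv u) - p) ^ 2
      + |p| / (2 * π ^ 2) + 1 / (2 * π ^ 4) := by
  have hY := abs_ipL2_le ((hu.continuous.pow 2).intervalIntegrable 0 1) hv2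
  have hP : nsqL2 u ≤ nsqL2 (deriv u) / π ^ 2 := by
    rw [le_div_iff₀' (by positivity)]
    exact pi_sq_mul_nsqL2_le_nsqL2_deriv hu h0 h1
  have hπ : 0 ≤ 1 / (π ^ 2) := by positivity
  have e1 : nsqL2 (deriv u) / π ^ 2 = nsqL2 (deriv u) * (1 / π ^ 2) := by ring
  have e2 : |p| / (2 * π ^ 2) = |p| * (1 / π ^ 2) / 2 := by ring
  have e3 : 1 / (2 * π ^ 4) = (1 / π ^ 2) ^ 2 / 2 := by ring
  rw [e1] at hP
  rw [e2, e3]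
  nlinarith [sq_nonneg (nsqL2 (deriv u) - p - 1 / π ^ 2), sq_nonneg (1 / π ^ 2),
    mul_le_mul_of_nonneg_right (le_abs_self p) hπ]
end
end
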